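/- For n ≥ 2, the odd graph O_n = K(2n-1, n-1) has eigenvalues λ_i^n = (-1)^{n+i} i for i = 1,...,n, and the multiplicity of λ_i^n equals the Catalan triangle entry E_{n-1,i-1}. In particular, the eigenvalue (-1)^{n+1} (= λ_1^n) has multiplicity equal to the n-th Catalan number C_n. -/

import Mathlib

open Polynomial

/-- The adjacency matrix of the Kneser graph `K(2n-1, n-1)` (the odd graph `O_n`). -/
def kneserAdj (n : ℕ) :
    Matrix {s : Finset (Fin (2 * n - 1)) // s.card = n - 1}
      {s : Finset (Fin (2 * n - 1)) // s.card = n - 1} ℝ :=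
  Matrix.of fun σ τ => if Disjoint σ.1 τ.1 then 1 else 0

section OddGraph
open Finset

theorem dcount {α : Type*} [Fintype α] [DecidableEq α] (u : ℕ) (F : Finset α → α → Finset α → ℝ) :
    ∑ ρ ∈ powersetCard u (univ : Finset α), ∑ x ∈ ρᶜ, F ρ x (insert x ρ)
      = ∑ τ ∈ powersetCard (u+1) (univ : Finset α), ∑ x ∈ τ, F (τ.erase x) x τ := by
  rw [Finset.sum_sigma', Finset.sum_sigma']
  refine Finset.sum_bij' (fun p _ => ⟨insert p.2 p.1, p.2⟩) (fun p _ => ⟨p.1.erase p.2, p.2⟩) ?_ ?_ ?_ ?_ ?_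
  · rintro ⟨ρ, x⟩ h
    simp [mem_powersetCard] at h ⊢
    rw [card_insert_of_notMem h.2, h.1]
  · rintro ⟨τ, x⟩ h
    simp [mem_powersetCard] at h ⊢
    rw [card_erase_of_mem h.2, h.1]; simp
  · rintro ⟨ρ, x⟩ h
    simp [mem_powersetCard] at h
    simp [erase_insert h.2]
  · rintro ⟨τ, x⟩ h
    simp [mem_powersetCard] at h
    simp [insert_erase h.2]
  · rintro ⟨ρ, x⟩ h
    simp [mem_powersetCard] at h
    simp [erase_insert h.2]

/-- partial sums of `H` over `t`-sets meeting `σ` in exactly `i` points -/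
noncomputable def asum {α : Type*} [Fintype α] [DecidableEq α] (H : Finset α → ℝ) (t : ℕ) (σ : Finset α) (i : ℕ) : ℝ :=
  ∑ τ ∈ powersetCard t (univ : Finset α), if (τ ∩ σ).card = i then H τ else 0

def Harm {α : Type*} [Fintype α] [DecidableEq α] (H : Finset α → ℝ) (t : ℕ) : Prop :=
  ∀ ρ : Finset α, ρ.card + 1 = t → ∑ x ∈ ρᶜ, H (insert x ρ) = 0

theorem asum_rec {α : Type*} [Fintype α] [DecidableEq α] (H : Finset α → ℝ) (u : ℕ)
    (hH : Harm H (u+1)) (σ : Finset α) (i : ℕ) :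
    ((i:ℝ)+1) * asum H (u+1) σ (i+1) + ((u:ℝ)+1-i) * asum H (u+1) σ i = 0 := by
  have h0 : ∑ ρ ∈ powersetCard u (univ : Finset α), ∑ x ∈ ρᶜ,
      (if (ρ ∩ σ).card = i then H (insert x ρ) else 0) = 0 := by
    apply Finset.sum_eq_zero
    intro ρ hρ
    rw [mem_powersetCard] at hρ
    by_cases hc : (ρ ∩ σ).card = i
    · simp [hc, hH ρ (by rw [hρ.2])]
    · simp [hc]
  rw [dcount u (fun ρ x τ => if (ρ ∩ σ).card = i then H τ else 0)] at h0
  rw [← h0, asum, asum, Finset.mul_sum, Finset.mul_sum, ← Finset.sum_add_distrib]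
  apply Finset.sum_congr rfl
  intro τ hτ
  rw [mem_powersetCard] at hτ
  have hcard : (τ ∩ σ).card + (τ \ σ).card = u + 1 := by rw [card_inter_add_card_sdiff, hτ.2]
  have key : ∀ x ∈ τ, (((τ.erase x) ∩ σ).card = i ↔ 
      (x ∈ σ ∧ (τ ∩ σ).card = i+1) ∨ (x ∉ σ ∧ (τ ∩ σ).card = i)) := by
    intro x hx
    rw [erase_inter]
    by_cases hs : x ∈ σ
    · have hm : x ∈ τ ∩ σ := mem_inter.mpr ⟨hx, hs⟩
      have := card_pos.mpr ⟨x, hm⟩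
      rw [card_erase_of_mem hm]
      simp [hs]; omega
    · rw [erase_eq_of_notMem (fun h => hs (mem_inter.mp h).2)]
      simp [hs]
  rw [← Finset.sum_inter_add_sum_sdiff τ σ]
  have e1 : ∑ x ∈ τ ∩ σ, (if ((τ.erase x) ∩ σ).card = i then H τ else 0) = 
     ((i:ℝ)+1) * (if (τ ∩ σ).card = i+1 then H τ else 0) := by
    rw [Finset.sum_congr rfl (g := fun _ => if (τ ∩ σ).card = i+1 then H τ else 0)]
    · rw [sum_const]; split_ifs with h <;> simp [h]
    · intro x hx
      rw [mem_inter] at hx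
      simp only [key x hx.1, hx.2]
      simp
  have e2 : ∑ x ∈ τ \ σ, (if ((τ.erase x) ∩ σ).card = i then H τ else 0) = 
     ((u:ℝ)+1-i) * (if (τ ∩ σ).card = i then H τ else 0) := by
    rw [Finset.sum_congr rfl (g := fun _ => if (τ ∩ σ).card = i then H τ else 0)]
    · rw [sum_const]; split_ifs with h
      · have : ((τ \ σ).card : ℝ) = u+1-i := by
          rw [h] at hcard
          have : (i:ℝ) + ((τ \ σ).card : ℝ) = u+1 := by exact_mod_cast hcard
          linarith
        simp [this]
      · simp
    · intro x hx
      rw [mem_sdiff] at hx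
      simp only [key x hx.1, hx.2]
      simp
  rw [e1, e2]

theorem asum_sign {α : Type*} [Fintype α] [DecidableEq α] (H : Finset α → ℝ) (t : ℕ)
    (hH : Harm H t) (σ : Finset α) : asum H t σ 0 = (-1)^t * asum H t σ t := by
  have main : ∀ i ≤ t, asum H t σ i = (-1)^i * (t.choose i) * asum H t σ 0 := by
    intro i
    induction i with
    | zero => simp
    | succ i ih =>
      intro hi
      obtain ⟨u, rfl⟩ : ∃ u, t = u+1 := ⟨t-1, by omega⟩
      have h1 := asum_rec H u hH σ i
      rw [ih (by omega)] at h1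
      have h2 := Nat.choose_succ_right_eq (u+1) i
      have h3 : ((u+1).choose (i+1) : ℝ) * (i+1) = (u+1).choose i * ((u:ℝ)+1-i) := by
        have := congrArg (Nat.cast : ℕ → ℝ) h2
        rw [Nat.cast_mul, Nat.cast_mul, Nat.cast_sub (by omega)] at this
        push_cast at this
        exact this
      have h4 : ((i:ℝ)+1) ≠ 0 := by positivity
      apply mul_left_cancel₀ h4
      rw [pow_succ]
      linear_combination h1 + (-1)^i * asum H (u+1) σ 0 * h3
  rw [main t le_rfl]
  simp [← mul_assoc, ← mul_pow]

theorem asum_top {α : Type*} [Fintype α] [DecidableEq α] (H : Finset α → ℝ) (t : ℕ) (σ : Finset α) :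
    asum H t σ t = ∑ τ ∈ powersetCard t σ, H τ := by
  rw [asum, ← Finset.sum_filter]
  apply Finset.sum_congr _ (fun _ _ => rfl)
  ext τ
  simp only [mem_filter, mem_powersetCard, subset_univ, true_and]
  constructor
  · rintro ⟨h1, h2⟩
    refine ⟨?_, h1⟩
    have := eq_of_subset_of_card_le (inter_subset_left (s₁ := τ) (s₂ := σ)) (by omega)
    rw [← this]; exact inter_subset_right
  · rintro ⟨h1, h2⟩
    rw [inter_eq_left.mpr h1]; simp [h2]

theorem asum_zero' {α : Type*} [Fintype α] [DecidableEq α] (H : Finset α → ℝ) (t : ℕ) (σ : Finset α) :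
    asum H t σ 0 = ∑ τ ∈ powersetCard t σᶜ, H τ := by
  rw [asum, ← Finset.sum_filter]
  apply Finset.sum_congr _ (fun _ _ => rfl)
  ext τ
  simp only [mem_filter, mem_powersetCard, subset_univ, true_and, card_eq_zero,
    ← disjoint_iff_inter_eq_empty, subset_compl_iff_disjoint_right]
  tauto

theorem descent {α : Type*} [Fintype α] [DecidableEq α] (H : Finset α → ℝ) (u : ℕ)
    (hH : Harm H (u+1)) (ρ : Finset α) :
    ∑ x ∈ ρᶜ, ∑ τ ∈ powersetCard (u+1) (insert x ρ), H τ =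
      ((Fintype.card α : ℝ) - ρ.card - (u+1)) * ∑ τ ∈ powersetCard (u+1) ρ, H τ := by
  have h1 := asum_rec H u hH ρ u
  rw [← asum_top H (u+1) ρ]
  have : ∑ x ∈ ρᶜ, ∑ τ ∈ powersetCard (u+1) (insert x ρ), H τ =
      ((Fintype.card α : ℝ) - ρ.card) * asum H (u+1) ρ (u+1) + asum H (u+1) ρ u := by
    have e : ∀ x ∈ ρᶜ, ∑ τ ∈ powersetCard (u+1) (insert x ρ), H τ = 
        ∑ τ ∈ powersetCard (u+1) ρ, H τ + ∑ τ' ∈ powersetCard u ρ, H (insert x τ') := by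
      intro x hx
      rw [powersetCard_succ_insert (by simpa using hx), sum_union, sum_image]
      · intro a ha b hb hab
        simp [mem_powersetCard] at ha hb hx
        rw [← erase_insert (fun h => hx (ha.1 h)), hab, erase_insert (fun h => hx (hb.1 h))]
      · rw [Finset.disjoint_left]
        intro a ha hb
        simp [mem_powersetCard] at ha hb hx
        obtain ⟨c, _, rfl⟩ := hb
        exact hx (ha.1 (mem_insert_self _ _))
    rw [Finset.sum_congr rfl e, sum_add_distrib, sum_const, ← asum_top H (u+1) ρ, card_compl, nsmul_eq_mul,
      Nat.cast_sub (card_le_univ _)]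
    congr 1
    rw [asum, ← Finset.sum_filter, Finset.sum_sigma']
    refine Finset.sum_bij (fun p _ => insert p.1 p.2) ?_ ?_ ?_ ?_
    · rintro ⟨x, τ⟩ h
      simp [mem_powersetCard] at h ⊢
      have : x ∉ τ := fun h' => h.1 (h.2.1 h')
      rw [card_insert_of_notMem this, insert_inter_of_notMem h.1, inter_eq_left.mpr h.2.1]
      simp [h.2.2]
    · rintro ⟨x, τ⟩ h ⟨y, τ'⟩ h' heq
      simp [mem_powersetCard] at h h' heq
      have e1 : τ = τ' := by
        have := congrArg (· ∩ ρ) heq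
        simpa [insert_inter_of_notMem h.1, insert_inter_of_notMem h'.1, inter_eq_left.mpr h.2.1, inter_eq_left.mpr h'.2.1] using this
      subst e1
      have : x ∈ insert y τ := heq ▸ mem_insert_self _ _
      rw [mem_insert] at this
      rcases this with rfl | h3
      · rfl
      · exact absurd (h.2.1 h3) h.1
    · intro τ hτ
      simp [mem_powersetCard] at hτ
      have : (τ \ ρ).card = 1 := by
        have := card_inter_add_card_sdiff τ ρ
        omega
      obtain ⟨x, hx⟩ := card_eq_one.mp this
      have hx' : x ∈ τ \ ρ := by rw [hx]; simp
      rw [mem_sdiff] at hx'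
      refine ⟨⟨x, τ ∩ ρ⟩, ?_, ?_⟩
      · simp [mem_powersetCard, hτ, hx'.2]
      · simp only
        rw [insert_eq, ← hx, sdiff_union_inter]
    · intros; rfl
  rw [this]
  linear_combination h1

theorem inj_step {α : Type*} [Fintype α] [DecidableEq α] (H : Finset α → ℝ) (t : ℕ)
    (hH : Harm H t) (s : ℕ) (hs : s + t < Fintype.card α)
    (h0 : ∀ σ : Finset α, σ.card = s+1 → ∑ τ ∈ powersetCard t σ, H τ = 0) :
    ∀ σ : Finset α, σ.card = s → ∑ τ ∈ powersetCard t σ, H τ = 0 := by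
  intro ρ hρ
  cases t with
  | zero =>
    obtain ⟨x, hx⟩ : ∃ x, x ∉ ρ := by
      by_contra! h
      have : ρ = univ := by ext; simp [h]
      rw [this, card_univ] at hρ; omega
    have := h0 (insert x ρ) (by rw [card_insert_of_notMem hx, hρ])
    simpa using this
  | succ u =>
    have h := descent H u hH ρ
    rw [Finset.sum_eq_zero] at h
    · have h2 : ((Fintype.card α : ℝ) - ρ.card - (u+1)) ≠ 0 := by
        have : (s:ℝ) + (u+1) < Fintype.card α := by exact_mod_cast hs
        rw [hρ]; intro h; linarith
      exact (mul_eq_zero.mp h.symm).resolve_left h2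
    · intro x hx
      apply h0
      rw [card_insert_of_notMem (by simpa using hx), hρ]

theorem inj_all {α : Type*} [Fintype α] [DecidableEq α] (H : Finset α → ℝ) (t : ℕ)
    (hH : Harm H t) (d : ℕ) (hs : t + d + t ≤ Fintype.card α)
    (h0 : ∀ σ : Finset α, σ.card = t + d → ∑ τ ∈ powersetCard t σ, H τ = 0) :
    ∀ σ : Finset α, σ.card = t → H σ = 0 := by
  induction d with
  | zero =>
    intro σ hσ
    have := h0 σ hσ
    rw [← hσ, powersetCard_self] at this
    simpa using this
  | succ d ih => 
    exact ih (by omega) (inj_step H t hH (t+d) (by omega) h0)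

theorem kn_eig {α : Type*} [Fintype α] [DecidableEq α] (H : Finset α → ℝ) (t k : ℕ)
    (hH : Harm H t) (htk : t ≤ k) (hN : Fintype.card α = 2 * k + 1) (σ : Finset α) (hσ : σ.card = k) :
    ∑ σ' ∈ powersetCard k σᶜ, ∑ τ ∈ powersetCard t σ', H τ
     = (-1)^t * ((k:ℝ) + 1 - t) * ∑ τ ∈ powersetCard t σ, H τ := by
  have hc : σᶜ.card = k+1 := by rw [card_compl]; omega
  have e0 : ∑ σ' ∈ powersetCard k σᶜ, ∑ τ ∈ powersetCard t σ', H τ = 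
      ∑ x ∈ σᶜ, ∑ τ ∈ powersetCard t (σᶜ.erase x), H τ := by
    symm
    refine Finset.sum_bij (fun x _ => σᶜ.erase x) ?_ ?_ ?_ ?_
    · intro x hx
      rw [mem_powersetCard, card_erase_of_mem hx, hc]
      exact ⟨erase_subset _ _, rfl⟩
    · intro x hx y hy h
      exact (erase_inj _ hx).mp h
    · intro τ hτ
      rw [mem_powersetCard] at hτ
      have : (σᶜ \ τ).card = 1 := by rw [card_sdiff_of_subset hτ.1]; omega
      obtain ⟨x, hx⟩ := card_eq_one.mp this
      have hx' : x ∈ σᶜ \ τ := by rw [hx]; simp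
      refine ⟨x, (mem_sdiff.mp hx').1, ?_⟩
      rw [erase_eq, ← hx, Finset.sdiff_sdiff_eq_self hτ.1]
    · intros; rfl
  have e1 : ∀ x ∈ σᶜ, ∑ τ ∈ powersetCard t (σᶜ.erase x), H τ = ∑ τ ∈ powersetCard t σᶜ, if x ∈ τ then 0 else H τ := by
    intro x hx
    rw [Finset.sum_ite, sum_const_zero, zero_add]
    apply Finset.sum_congr _ (fun _ _ => rfl)
    ext τ
    simp only [mem_powersetCard, mem_filter, subset_erase]
    tauto
  rw [e0, Finset.sum_congr rfl e1, sum_comm]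
  have e2 : ∀ τ ∈ powersetCard t σᶜ, (∑ x ∈ σᶜ, if x ∈ τ then 0 else H τ) = ((k:ℝ)+1-t) * H τ := by
    intro τ hτ
    rw [mem_powersetCard] at hτ
    rw [Finset.sum_ite, sum_const_zero, zero_add, sum_const, nsmul_eq_mul]
    congr 1
    have : (σᶜ.filter (fun x => x ∉ τ)) = σᶜ \ τ := by ext; simp
    rw [this, card_sdiff_of_subset hτ.1, hc, hτ.2, Nat.cast_sub (by omega)]
    push_cast; ring
  rw [Finset.sum_congr rfl e2, ← Finset.mul_sum, ← asum_zero', ← asum_top, asum_sign H t hH]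
  ring

theorem E_formula (E : ℕ → ℤ → ℕ)
    (hE0 : E 0 0 = 1)
    (hEzero : ∀ (m : ℕ) (k : ℤ), (k < 0 ∨ (m : ℤ) < k) → E m k = 0)
    (hErec : ∀ m : ℕ, 1 ≤ m → ∀ k : ℤ, 0 ≤ k → k ≤ (m : ℤ) →
      E m k = E (m - 1) (k - 1) + 2 * E (m - 1) k + E (m - 1) (k + 1)) (m : ℕ) :
    E m m = 1 ∧ ∀ j ≤ m, E m (m - (j+1:ℕ)) + (2*m+1).choose j = (2*m+1).choose (j+1) := by
  induction m with
  | zero =>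
    refine ⟨by simpa using hE0, ?_⟩
    intro j hj
    obtain rfl : j = 0 := by omega
    rw [hEzero _ _ (Or.inl (by simp))]; simp
  | succ m ih =>
    obtain ⟨i1, i2⟩ := ih
    have z1 := hEzero m (m+1) (Or.inr (by omega))
    have z2 := hEzero m (m+2) (Or.inr (by omega))
    constructor
    · rw [hErec (m+1) (by omega) _ (by positivity) le_rfl]
      simp only [Nat.add_sub_cancel]
      push_cast
      rw [show (m:ℤ)+1-1 = m by ring, show (m:ℤ)+1+1 = m+2 by ring, z1, z2, i1]
    · intro j hj
      rcases Nat.lt_or_ge j (m+1) with hj' | hj'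
      · rw [hErec (m+1) (by omega) _ (by push_cast; omega) (by push_cast; omega)]
        simp only [Nat.add_sub_cancel]
        have a1 := i2 j (by omega)
        rw [show ((m+1:ℕ):ℤ) - (j+1:ℕ) - 1 = m - (j+1:ℕ) by push_cast; ring]
        have p1 : ∀ r, (2*(m+1)+1).choose (r+2) = (2*m+1).choose (r+2) + 2 * (2*m+1).choose (r+1) + (2*m+1).choose r := by
          intro r
          rw [show 2*(m+1)+1 = (2*m+1)+1+1 by ring, Nat.choose_succ_succ, Nat.choose_succ_succ (2*m+1), Nat.choose_succ_succ (2*m+1)]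
          ring
        have p2 : (2*(m+1)+1).choose 1 = (2*m+1).choose 1 + 2 := by simp; omega
        match j, hj', a1 with
        | 0, _, a1 =>
          rw [show ((m+1:ℕ):ℤ) - (0+1:ℕ) = m by push_cast; ring, i1, z1]
          simp at a1 ⊢; omega
        | 1, _, a1 =>
          have a2 := i2 0 (by omega)
          rw [show ((m+1:ℕ):ℤ) - (1+1:ℕ) = m - (0+1:ℕ) by push_cast; ring, 
             show (m:ℤ) - (0+1:ℕ) + 1 = m by push_cast; ring, i1]
          have := p1 0
          simp only [zero_add, Nat.reduceAdd, Nat.choose_zero_right] at *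
          omega
        | j+2, _, a1 =>
          have a2 := i2 (j+1) (by omega)
          have a3 := i2 j (by omega)
          rw [show ((m+1:ℕ):ℤ) - (j+2+1:ℕ) = m - (j+1+1:ℕ) by push_cast; ring, 
             show (m:ℤ) - (j+1+1:ℕ) + 1 = m - (j+1:ℕ) by push_cast; ring]
          have := p1 j
          have := p1 (j+1)
          simp only [add_assoc, Nat.reduceAdd] at *
          omega
      · obtain rfl : j = m+1 := by omega
        rw [hEzero _ _ (Or.inl (by push_cast; omega)), zero_add]
        exact Nat.choose_symm_of_eq_add (by ring)

theorem cat_formula (m : ℕ) (e : ℕ) (he : e + (2*(m+1)+1).choose m = (2*(m+1)+1).choose (m+1)) :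
    e = catalan (m+2) := by
  have h1 := Nat.succ_mul_centralBinom_succ (m+1)
  have h2 := succ_mul_catalan_eq_centralBinom (m+2)
  have h3 := Nat.add_one_mul_choose_eq (2*(m+1)+1) (m+1)
  have h4 := Nat.choose_succ_right_eq (2*(m+1)+1) m
  have h5 : (2*(m+1)+1+1) = 2*(m+2) := by ring
  rw [h5, show m+1+1 = m+2 by ring, ← Nat.centralBinom_eq_two_mul_choose, ← h2] at h3
  rw [show 2*(m+1)+1 - m = m+3 by omega] at h4
  have h6 : 2 * (2*(m+1)+1).choose (m+1) = (m+2+1) * catalan (m+2) := by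
    apply Nat.eq_of_mul_eq_mul_left (show 0 < m+2 by omega)
    linarith
  have : (m+3) * e = (m+3) * catalan (m+2) := by
    nlinarith
  exact Nat.eq_of_mul_eq_mul_left (by omega) this

theorem E_sum (E : ℕ → ℤ → ℕ) (m : ℕ) (h1 : E m m = 1)
    (h2 : ∀ j ≤ m, E m (m - (j+1:ℕ)) + (2*m+1).choose j = (2*m+1).choose (j+1)) (J : ℕ) (hJ : J ≤ m) :
    ∑ j ∈ range (J+1), E m (m - (j:ℕ)) = (2*m+1).choose J := by
  induction J with
  | zero => simp [h1]
  | succ J ih =>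
    rw [sum_range_succ, ih (by omega), ← h2 J (by omega), add_comm]

/-- extension by zero of a function on `t`-sets -/
noncomputable def extL (α : Type*) [Fintype α] [DecidableEq α] (t : ℕ) :
    ({s : Finset α // s.card = t} → ℝ) →ₗ[ℝ] (Finset α → ℝ) where
  toFun h := fun s => if hs : s.card = t then h ⟨s, hs⟩ else 0
  map_add' f g := by funext s; by_cases hs : s.card = t <;> simp [hs]
  map_smul' c g := by funext s; by_cases hs : s.card = t <;> simp [hs]

noncomputable def downL (α : Type*) [Fintype α] [DecidableEq α] (t : ℕ) :
    ({s : Finset α // s.card = t} → ℝ) →ₗ[ℝ] ({s : Finset α // s.card + 1 = t} → ℝ) where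
  toFun h := fun ρ => ∑ x ∈ ρ.1ᶜ, extL α t h (insert x ρ.1)
  map_add' f g := by funext s; simp [sum_add_distrib]
  map_smul' c g := by funext s; simp [mul_sum]

noncomputable def upL (α : Type*) [Fintype α] [DecidableEq α] (t k : ℕ) :
    ({s : Finset α // s.card = t} → ℝ) →ₗ[ℝ] ({s : Finset α // s.card = k} → ℝ) where
  toFun h := fun σ => ∑ τ ∈ powersetCard t σ.1, extL α t h τ
  map_add' f g := by funext s; simp [sum_add_distrib]
  map_smul' c g := by funext s; simp [mul_sum]

theorem harm_of_ker {α : Type*} [Fintype α] [DecidableEq α] (t : ℕ)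
    (h : {s : Finset α // s.card = t} → ℝ) (hh : h ∈ LinearMap.ker (downL α t)) :
    Harm (extL α t h) t := by
  intro ρ hρ
  exact congrFun (LinearMap.mem_ker.mp hh) ⟨ρ, hρ⟩

theorem ker_dim {α : Type*} [Fintype α] [DecidableEq α] (t : ℕ) :
    (Fintype.card α).choose t ≤ Module.finrank ℝ (LinearMap.ker (downL α t)) +
      Fintype.card {s : Finset α // s.card + 1 = t} := by
  have h := LinearMap.finrank_range_add_finrank_ker (downL α t)
  have h2 := Submodule.finrank_le (LinearMap.range (downL α t))
  rw [Module.finrank_fintype_fun_eq_card] at h h2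
  rw [Fintype.card_finset_len] at h
  omega

theorem ker_le_eig (n t : ℕ) (hn : 2 ≤ n) (ht : t ≤ n - 1) :
    Module.finrank ℝ (LinearMap.ker (downL (Fin (2*n-1)) t)) ≤
     Module.finrank ℝ (Module.End.eigenspace (Matrix.toLin' (kneserAdj n)) ((-1)^t * ((n:ℝ) - t))) := by
  have hcard : Fintype.card (Fin (2*n-1)) = 2 * (n-1) + 1 := by rw [Fintype.card_fin]; omega
  have hmem : ∀ h ∈ LinearMap.ker (downL (Fin (2*n-1)) t), upL (Fin (2*n-1)) t (n-1) h ∈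
      Module.End.eigenspace (Matrix.toLin' (kneserAdj n)) ((-1)^t * ((n:ℝ) - t)) := by
    intro h hh
    rw [Module.End.mem_eigenspace_iff]
    funext σ
    have key := kn_eig (extL _ t h) t (n-1) (harm_of_ker t h hh) ht hcard σ.1 σ.2
    have hn' : ((n-1:ℕ):ℝ) + 1 = n := by rw [Nat.cast_sub (by omega)]; simp
    rw [hn'] at key
    rw [Matrix.toLin'_apply, Pi.smul_apply, smul_eq_mul]
    refine Eq.trans ?_ key
    simp only [Matrix.mulVec, dotProduct, kneserAdj, Matrix.of_apply, ite_mul, one_mul, zero_mul]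
    rw [← Finset.sum_filter]
    refine Finset.sum_bij (fun s _ => s.1) ?_ ?_ ?_ ?_
    · rintro ⟨s, hs⟩ h'
      simp only [mem_filter, mem_univ, true_and] at h'
      rw [mem_powersetCard, subset_compl_iff_disjoint_right]
      exact ⟨h'.symm, hs⟩
    · intro a _ b _ hab
      exact Subtype.ext hab
    · intro s hs
      rw [mem_powersetCard, subset_compl_iff_disjoint_right] at hs
      refine ⟨⟨s, hs.2⟩, ?_, rfl⟩
      simp only [mem_filter, mem_univ, true_and]
      exact hs.1.symm
    · intros; rfl
  refine LinearMap.finrank_le_finrank_of_injective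
    (f := (upL (Fin (2*n-1)) t (n-1)).restrict hmem) ?_
  rw [injective_iff_map_eq_zero]
  rintro ⟨h, hh⟩ h0
  have h0' : upL (Fin (2*n-1)) t (n-1) h = 0 := congrArg Subtype.val h0
  have := inj_all (extL _ t h) t (harm_of_ker t h hh) (n-1-t) (by rw [hcard]; omega) (by
    intro σ hσ
    exact congrFun h0' ⟨σ, by omega⟩)
  apply Subtype.ext
  funext ⟨s, hs⟩
  have h3 := this s hs
  simpa [extL, hs] using h3

theorem mult_le (n t : ℕ) (hn : 2 ≤ n) (ht : t ≤ n - 1) (e : ℕ)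
    (he : e + Fintype.card {s : Finset (Fin (2*n-1)) // s.card + 1 = t} = (2*n-1).choose t) :
    (X - C ((-1:ℝ)^t * ((n:ℝ) - t)))^e ∣ (kneserAdj n).charpoly := by
  have h1 := ker_dim (α := Fin (2*n-1)) t
  rw [Fintype.card_fin] at h1
  have h2 := ker_le_eig n t hn ht
  have h3 := LinearMap.finrank_eigenspace_le (Matrix.toLin' (kneserAdj n)) ((-1)^t * ((n:ℝ) - t))
  rw [Matrix.charpoly_toLin'] at h3
  exact (pow_dvd_pow _ (by omega)).trans (pow_rootMultiplicity_dvd _ _)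

theorem eig_inj (n i j : ℕ) (hij : i ≠ j) :
    ((-1 : ℝ) ^ (n + i) * (i : ℝ)) ≠ ((-1 : ℝ) ^ (n + j) * (j : ℝ)) := by
  intro h
  have := congrArg abs h
  simp [abs_mul] at this
  exact hij this

end OddGraph

/-- the odd graph `O_n` has eigenvalues `λ_i = (-1)^{n+i} i` for
`i = 1,…,n`, the multiplicity of `λ_i` being the Catalan triangle entry `E_{n-1,i-1}`;
in particular the eigenvalue `(-1)^{n+1}` has multiplicity `C_n`. -/
theorem stmt14 (n : ℕ) (hn : 2 ≤ n) (E : ℕ → ℤ → ℕ)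
    (hE0 : E 0 0 = 1)
    (hEzero : ∀ (m : ℕ) (k : ℤ), (k < 0 ∨ (m : ℤ) < k) → E m k = 0)
    (hErec : ∀ m : ℕ, 1 ≤ m → ∀ k : ℤ, 0 ≤ k → k ≤ (m : ℤ) →
      E m k = E (m - 1) (k - 1) + 2 * E (m - 1) k + E (m - 1) (k + 1)) :
    Matrix.charpoly (kneserAdj n) =
      ∏ i ∈ Finset.Icc 1 n,
        (X - C ((-1 : ℝ) ^ (n + i) * (i : ℝ))) ^ (E (n - 1) ((i : ℤ) - 1)) ∧
    E (n - 1) 0 = catalan n := by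
  obtain ⟨h1, h2⟩ := E_formula E hE0 hEzero hErec (n-1)
  have hc : 2 * (n - 1) + 1 = 2 * n - 1 := by omega
  have hcat : E (n - 1) 0 = catalan n := by
    obtain ⟨m, rfl⟩ : ∃ m, n = m + 2 := ⟨n - 2, by omega⟩
    apply cat_formula
    have := h2 m (by omega)
    simpa using this
  refine ⟨?_, hcat⟩
  refine eq_of_monic_of_dvd_of_natDegree_le ?_ (Matrix.charpoly_monic _) ?_ ?_
  · exact monic_prod_of_monic _ _ (fun i _ => (monic_X_sub_C _).pow _)
  · apply Finset.prod_dvd_of_coprime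
    · intro i _ j _ hij
      exact (isCoprime_X_sub_C_of_isUnit_sub
        (sub_ne_zero.mpr (eig_inj n i j hij)).isUnit).pow
    · intro i hi
      rw [Finset.mem_Icc] at hi
      have hlam : (-1 : ℝ) ^ (n + i) * (i : ℝ) = (-1) ^ (n - i) * ((n : ℝ) - (n - i : ℕ)) := by
        rw [Nat.cast_sub hi.2, show n + i = (n - i) + 2 * i by omega, pow_add, pow_mul]
        simp
      rw [hlam]
      apply mult_le n (n - i) hn (by omega)
      rcases Nat.eq_or_lt_of_le hi.2 with rfl | hlt
      · have e1 : ((i : ℤ) - 1) = ((i - 1 : ℕ) : ℤ) := by omega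
        rw [e1, h1]
        simp
      · have h3 := h2 (n - i - 1) (by omega)
        rw [hc] at h3
        have e1 : ((n - 1 : ℕ) : ℤ) - ((n - i - 1 + 1 : ℕ) : ℤ) = (i : ℤ) - 1 := by omega
        have e2 : n - i - 1 + 1 = n - i := by omega
        rw [e1, e2] at h3
        rw [← h3]
        congr 1
        have e3 : ∀ s : Finset (Fin (2 * n - 1)), s.card + 1 = n - i ↔ s.card = n - i - 1 := by
          intro s; omega
        rw [Fintype.card_congr (Equiv.subtypeEquivRight e3), Fintype.card_finset_len,
          Fintype.card_fin]
  · rw [Matrix.charpoly_natDegree_eq_dim, Fintype.card_finset_len, Fintype.card_fin,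
      natDegree_prod_of_monic _ _ (fun i _ => (monic_X_sub_C _).pow _)]
    have h3 := E_sum E (n - 1) h1 h2 (n - 1) le_rfl
    rw [hc] at h3
    rw [← h3]
    apply le_of_eq
    refine Finset.sum_bij (fun j _ => n - j) ?_ ?_ ?_ ?_
    · intro j hj
      rw [Finset.mem_range] at hj
      rw [Finset.mem_Icc]; omega
    · intro a ha b hb hab
      rw [Finset.mem_range] at ha hb
      omega
    · intro i hi
      rw [Finset.mem_Icc] at hi
      exact ⟨n - i, by rw [Finset.mem_range]; omega, by omega⟩
    · intro j hj
      rw [Finset.mem_range] at hj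
      rw [natDegree_pow, natDegree_X_sub_C, mul_one]
      congr 1
      omega
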